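/- arXiv:1008.1037 — 5 statements merged into one kernel-verified Lean document; each statement's English description precedes it below -/
import Mathlib

section
/- (Strong Exchange) Let (X, hgt) be a quasiparabolic W-set, x ∈ X, r ∈ R(W), and let s_1, …, s_k ∈ S with w = s_1 s_2 ⋯ s_k. If hgt(r·x) > hgt(x) and hgt(w·r·x) < hgt(w·x), then there exists an index i with 1 ≤ i ≤ k such that w·r·x = s_1 ⋯ s_{i−1} s_{i+1} ⋯ s_k·x. -/
open CoxeterSystem

variable {B W : Type*} [Group W] {M : CoxeterMatrix B}

/-- A scaled `W`-set: heights change by at most 1 under simple reflections. -/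
def IsScaled (cs : CoxeterSystem M W) {X : Type*} [MulAction W X] (hgt : X → ℤ) : Prop :=
  ∀ (b : B) (x : X), |hgt (cs.simple b • x) - hgt x| ≤ 1

/-- A quasiparabolic `W`-set: scaled, plus (QP1) and (QP2). -/
def IsQuasiparabolic (cs : CoxeterSystem M W) {X : Type*} [MulAction W X] (hgt : X → ℤ) : Prop :=
  IsScaled cs hgt ∧
  (∀ (r : W) (x : X), cs.IsReflection r → hgt (r • x) = hgt x → r • x = x) ∧
  (∀ (r : W) (b : B) (x : X), cs.IsReflection r → hgt x < hgt (r • x) →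
    hgt (cs.simple b • r • x) < hgt (cs.simple b • x) → r • x = cs.simple b • x)
/-- Strong Exchange: if `hgt (r • x) > hgt x` and
`hgt (w • r • x) < hgt (w • x)` where `w` is the product of the word `l` of simple
reflections, then `w • r • x` is obtained by deleting some letter of `l`. -/
theorem strong_exchange (cs : CoxeterSystem M W) {X : Type*} [MulAction W X]
    (hgt : X → ℤ) (hqp : IsQuasiparabolic cs hgt) (x : X) (r : W) (hr : cs.IsReflection r)
    (l : List B)
    (h1 : hgt x < hgt (r • x))
    (h2 : hgt (cs.wordProd l • r • x) < hgt (cs.wordProd l • x)) :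
    ∃ i : ℕ, i < l.length ∧
      cs.wordProd l • r • x = cs.wordProd (l.eraseIdx i) • x := by
  induction l with
  | nil =>
    simp only [cs.wordProd_nil, one_smul] at h2
    exact absurd h2 h1.not_gt
  | cons b l ih =>
    obtain ⟨-, qp1, qp2⟩ := hqp
    have hconj : cs.wordProd l • r • x
        = (cs.wordProd l * r * (cs.wordProd l)⁻¹) • cs.wordProd l • x := by
      simp only [mul_smul, inv_smul_smul]
    have hrefl := hr.conj (cs.wordProd l)
    simp only [cs.wordProd_cons, mul_smul] at h2 ⊢
    rcases lt_trichotomy (hgt (cs.wordProd l • r • x)) (hgt (cs.wordProd l • x)) with h | h | h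
    · obtain ⟨i, hi, heq⟩ := ih h
      refine ⟨i + 1, Nat.succ_lt_succ hi, ?_⟩
      rw [heq, List.eraseIdx_cons_succ, cs.wordProd_cons, mul_smul]
    · rw [hconj] at h h2
      rw [qp1 _ _ hrefl h] at h2
      exact absurd h2 (lt_irrefl _)
    · refine ⟨0, Nat.succ_pos _, ?_⟩
      rw [hconj] at h h2 ⊢
      rw [qp2 _ b _ hrefl h h2, List.eraseIdx_cons_zero, ← mul_smul, cs.simple_mul_simple_self,
        one_smul]
end

section
/- Let x be a W-minimal element of a quasiparabolic W-set (X, hgt). Then for all w ∈ W one has hgt(w·x) ≥ hgt(x), with equality if and only if w·x = x. -/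
open CoxeterSystem

variable {B W : Type*} [Group W] {M : CoxeterMatrix B}

/-- One step of the Bruhat order on a scaled `W`-set: a reflection raising the height. -/
def BruhatStep (cs : CoxeterSystem M W) {X : Type*} [MulAction W X] (hgt : X → ℤ)
    (u v : X) : Prop :=
  ∃ r : W, cs.IsReflection r ∧ v = r • u ∧ hgt u < hgt v

/-- The Bruhat order on a scaled `W`-set. -/
def BruhatLE (cs : CoxeterSystem M W) {X : Type*} [MulAction W X] (hgt : X → ℤ) : X → X → Prop :=
  Relation.ReflTransGen (BruhatStep cs hgt)

theorem BruhatLE.eq_or_lt {cs : CoxeterSystem M W} {X : Type*} [MulAction W X] {hgt : X → ℤ}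
    {u v : X} (h : BruhatLE cs hgt u v) : u = v ∨ hgt u < hgt v := by
  induction h with
  | refl => exact Or.inl rfl
  | tail _ hstep ih =>
    obtain ⟨_, _, _, hlt⟩ := hstep
    rcases ih with rfl | ih
    · exact Or.inr hlt
    · exact Or.inr (ih.trans hlt)

/-- A Bruhat step `u < v` either persists or collapses after applying a simple reflection `s`,
or else `v = s • u`. -/
theorem BruhatStep.simple_smul {cs : CoxeterSystem M W} {X : Type*} [MulAction W X] {hgt : X → ℤ}
    (hqp : IsQuasiparabolic cs hgt) {u v : X} (h : BruhatStep cs hgt u v) (b : B) :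
    BruhatLE cs hgt (cs.simple b • u) (cs.simple b • v) ∨ v = cs.simple b • u := by
  obtain ⟨-, hqp1, hqp2⟩ := hqp
  obtain ⟨r, hr, rfl, hlt⟩ := h
  have hconj : cs.IsReflection (cs.simple b * r * (cs.simple b)⁻¹) := hr.conj _
  have hsmul : (cs.simple b * r * (cs.simple b)⁻¹) • cs.simple b • u
      = cs.simple b • r • u := by
    simp only [mul_smul, inv_smul_smul]
  rcases lt_trichotomy (hgt (cs.simple b • u)) (hgt (cs.simple b • r • u)) with h | h | h
  · exact Or.inl (.single ⟨_, hconj, hsmul.symm, h⟩)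
  · have heq := hqp1 _ (cs.simple b • u) hconj (by rw [hsmul, h])
    rw [hsmul] at heq
    exact Or.inl (heq ▸ .refl)
  · exact Or.inr (hqp2 r b u hr hlt h)

/-- The lifting property: a common lower bound of `u` and `s • u` is a lower bound of `v` and
`s • v` whenever `u ≤ v`. -/
theorem BruhatLE.lifting {cs : CoxeterSystem M W} {X : Type*} [MulAction W X] {hgt : X → ℤ}
    (hqp : IsQuasiparabolic cs hgt) {u v z : X} (h : BruhatLE cs hgt u v) (b : B)
    (hzu : BruhatLE cs hgt z u) (hzsu : BruhatLE cs hgt z (cs.simple b • u)) :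
    BruhatLE cs hgt z v ∧ BruhatLE cs hgt z (cs.simple b • v) := by
  induction h with
  | refl => exact ⟨hzu, hzsu⟩
  | tail _ hstep ih =>
    refine ⟨ih.1.tail hstep, ?_⟩
    rcases hstep.simple_smul hqp b with h | rfl
    · exact ih.2.trans h
    · rw [smul_smul, cs.simple_mul_simple_self, one_smul]
      exact ih.1

/-- A `W`-minimal element is the least element of its orbit in the Bruhat order. -/
theorem bruhatLE_smul_of_minimal {cs : CoxeterSystem M W} {X : Type*} [MulAction W X]
    {hgt : X → ℤ} (hqp : IsQuasiparabolic cs hgt) {x : X}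
    (hmin : ∀ b : B, hgt x ≤ hgt (cs.simple b • x)) (w : W) : BruhatLE cs hgt x (w • x) := by
  induction w using cs.simple_induction_left with
  | one => rw [one_smul]; exact .refl
  | mul_simple_left w b ih =>
    rw [mul_smul]
    refine (ih.lifting hqp b .refl ?_).2
    rcases (hmin b).lt_or_eq with h | h
    · exact .single ⟨_, cs.isReflection_simple b, rfl, h⟩
    · rw [hqp.2.1 _ x (cs.isReflection_simple b) h.symm]
      exact .refl

/-- if `x` is a `W`-minimal element of a quasiparabolic `W`-set, then
`hgt (w • x) ≥ hgt x` for all `w`, with equality iff `w • x = x`. -/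
theorem minimal_is_minimum (cs : CoxeterSystem M W) {X : Type*} [MulAction W X]
    (hgt : X → ℤ) (hqp : IsQuasiparabolic cs hgt) (x : X)
    (hmin : ∀ b : B, hgt x ≤ hgt (cs.simple b • x)) (w : W) :
    hgt x ≤ hgt (w • x) ∧ (hgt (w • x) = hgt x ↔ w • x = x) := by
  rcases (bruhatLE_smul_of_minimal hqp hmin w).eq_or_lt with h | h
  · rw [← h]
    exact ⟨le_rfl, iff_of_true rfl rfl⟩
  · exact ⟨h.le, iff_of_false h.ne' fun heq => h.ne (by rw [heq])⟩
end

section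
/- Let x₀ be a W-minimal element of a transitive quasiparabolic W-set (X, hgt). Then for every y ∈ X, hgt(y) = hgt(x₀) + min{ℓ(w) : w ∈ W, w·x₀ = y}; that is, there exists w ∈ W with w·x₀ = y and ℓ(w) = hgt(y) − hgt(x₀), and every w ∈ W with w·x₀ = y satisfies ℓ(w) ≥ hgt(y) − hgt(x₀). -/
open CoxeterSystem

variable {B W : Type*} [Group W] {M : CoxeterMatrix B}

namespace IsQuasiparabolic

variable {cs : CoxeterSystem M W} {X : Type*} [MulAction W X] {hgt : X → ℤ}

/-- Strong exchange condition: if a word reverses the height order of `x` and `r • x`, then its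
action on `r • x` agrees with the action on `x` of some word that is one letter shorter. -/
theorem exists_wordProd_smul_eq (hqp : IsQuasiparabolic cs hgt) {r : W} (hr : cs.IsReflection r)
    {x : X} (hx : hgt x < hgt (r • x)) (ω : List B)
    (hω : hgt (cs.wordProd ω • r • x) ≤ hgt (cs.wordProd ω • x)) :
    ∃ ω' : List B, ω'.length + 1 = ω.length ∧
      cs.wordProd ω • r • x = cs.wordProd ω' • x := by
  induction ω with
  | nil => simp at hω; omega
  | cons b ω ih =>
    by_cases h : hgt (cs.wordProd ω • r • x) ≤ hgt (cs.wordProd ω • x)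
    · obtain ⟨ω', hlen, heq⟩ := ih h
      refine ⟨b :: ω', by simp [hlen], ?_⟩
      rw [cs.wordProd_cons, cs.wordProd_cons, mul_smul, heq, mul_smul]
    · rw [not_le] at h
      simp only [cs.wordProd_cons, mul_smul] at hω ⊢
      set z := cs.wordProd ω • x with hz
      set r' := cs.wordProd ω * r * (cs.wordProd ω)⁻¹ with hr'_def
      have hr' : cs.IsReflection r' := hr.conj _
      have hrz : cs.wordProd ω • r • x = r' • z := by
        simp [hz, hr'_def, mul_smul]
      rw [hrz] at h hω ⊢
      rcases hω.lt_or_eq with hlt | heq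
      · refine ⟨ω, rfl, ?_⟩
        rw [hqp.2.2 r' b z hr' h hlt, smul_smul, cs.simple_mul_simple_self, one_smul]
      · have hconj : (cs.simple b * r' * (cs.simple b)⁻¹) • cs.simple b • z
            = cs.simple b • r' • z := by
          simp only [mul_smul, inv_smul_smul]
        have hfix := hqp.2.1 _ (cs.simple b • z) (hr'.conj (cs.simple b)) (by rw [hconj, heq])
        rw [hconj] at hfix
        rw [smul_left_cancel _ hfix] at h
        exact absurd h (lt_irrefl _)

/-- A `W`-minimal element has the smallest height in its orbit. -/
theorem hgt_le_hgt_wordProd_smul (hqp : IsQuasiparabolic cs hgt) {x₀ : X}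
    (hmin : ∀ b : B, hgt x₀ ≤ hgt (cs.simple b • x₀)) (ω : List B) :
    hgt x₀ ≤ hgt (cs.wordProd ω • x₀) := by
  induction hn : ω.length using Nat.strong_induction_on generalizing ω with
  | _ n ih =>
    rcases ω.eq_nil_or_concat with rfl | ⟨υ, b, rfl⟩
    · simp
    · rw [List.length_concat] at hn
      have hυ := ih υ.length (by omega) υ rfl
      rw [cs.wordProd_concat, mul_smul]
      rcases (hmin b).eq_or_lt with heq | hlt
      · rwa [hqp.2.1 _ x₀ (cs.isReflection_simple b) heq.symm]
      · by_contra! hcon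
        obtain ⟨ω', hlen, heq⟩ := hqp.exists_wordProd_smul_eq (cs.isReflection_simple b) hlt υ
          (hcon.le.trans hυ)
        rw [heq] at hcon
        exact absurd (ih ω'.length (by omega) ω' rfl) (not_le.mpr hcon)

/-- A word of minimal length taking the `W`-minimal element `x₀` to a given element raises the
height by exactly one at each letter. -/
theorem hgt_wordProd_smul_of_minimal (hqp : IsQuasiparabolic cs hgt) {x₀ : X}
    (hmin : ∀ b : B, hgt x₀ ≤ hgt (cs.simple b • x₀)) (ω : List B)
    (hω : ∀ ω' : List B, cs.wordProd ω' • x₀ = cs.wordProd ω • x₀ → ω.length ≤ ω'.length) :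
    hgt (cs.wordProd ω • x₀) = hgt x₀ + ω.length := by
  induction ω with
  | nil => simp
  | cons b ω ih =>
    have hz := ih fun ω' h => by
      have := hω (b :: ω') (by simp only [cs.wordProd_cons, mul_smul, h])
      simpa using this
    simp only [cs.wordProd_cons, mul_smul, List.length_cons] at hω ⊢
    have hne : cs.simple b • cs.wordProd ω • x₀ ≠ cs.wordProd ω • x₀ := fun h => by
      have := hω ω h.symm
      omega
    have hscaled := abs_le.mp (hqp.1 b (cs.wordProd ω • x₀))
    rcases lt_trichotomy (hgt (cs.simple b • cs.wordProd ω • x₀)) (hgt (cs.wordProd ω • x₀))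
      with hlt | heq | hgt'
    · exfalso
      set r := (cs.wordProd ω)⁻¹ * cs.simple b * (cs.wordProd ω)⁻¹⁻¹ with hr_def
      have hr : cs.IsReflection r := (cs.isReflection_simple b).conj _
      have hrx : cs.wordProd ω • r • x₀ = cs.simple b • cs.wordProd ω • x₀ := by
        simp [hr_def, mul_smul]
      obtain ⟨υ, hυ⟩ := cs.wordProd_surjective r
      have hle := hqp.hgt_le_hgt_wordProd_smul hmin υ
      rw [hυ] at hle
      rcases hle.eq_or_lt with heq | hlt'
      · rw [hqp.2.1 r x₀ hr heq.symm] at hrx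
        exact hne hrx.symm
      · obtain ⟨ω', hlen, h⟩ := hqp.exists_wordProd_smul_eq hr hlt' ω (by rw [hrx]; exact hlt.le)
        have := hω ω' (by rw [← h, hrx])
        omega
    · exact absurd (hqp.2.1 _ _ (cs.isReflection_simple b) heq) hne
    · push_cast
      omega

end IsQuasiparabolic

/-- In a scaled `W`-set, a word raises the height by at most its length. -/
theorem IsScaled.hgt_wordProd_smul_le {cs : CoxeterSystem M W} {X : Type*} [MulAction W X]
    {hgt : X → ℤ} (hs : IsScaled cs hgt) (x : X) (ω : List B) :
    hgt (cs.wordProd ω • x) ≤ hgt x + ω.length := by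
  induction ω with
  | nil => simp
  | cons b ω ih =>
    have := (abs_le.mp (hs b (cs.wordProd ω • x))).2
    rw [cs.wordProd_cons, mul_smul, List.length_cons]
    push_cast
    omega

/-- in a transitive quasiparabolic `W`-set with `W`-minimal element `x₀`,
the height of any `y` equals `hgt x₀` plus the minimal length of `w` with `w • x₀ = y`. -/
theorem height_eq_min_length (cs : CoxeterSystem M W) {X : Type*} [MulAction W X]
    [MulAction.IsPretransitive W X]
    (hgt : X → ℤ) (hqp : IsQuasiparabolic cs hgt) (x₀ : X)
    (hmin : ∀ b : B, hgt x₀ ≤ hgt (cs.simple b • x₀)) (y : X) :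
    (∃ w : W, w • x₀ = y ∧ (cs.length w : ℤ) = hgt y - hgt x₀) ∧
    (∀ w : W, w • x₀ = y → hgt y - hgt x₀ ≤ (cs.length w : ℤ)) := by
  have hupper : ∀ w : W, w • x₀ = y → hgt y - hgt x₀ ≤ (cs.length w : ℤ) := by
    intro w hw
    obtain ⟨ω, hred, rfl⟩ := cs.exists_isReduced w
    have := hqp.1.hgt_wordProd_smul_le x₀ ω
    rw [hw] at this
    rw [hred.eq]
    omega
  refine ⟨?_, hupper⟩
  obtain ⟨w, hw⟩ := MulAction.exists_smul_eq W x₀ y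
  obtain ⟨υ, rfl⟩ := cs.wordProd_surjective w
  obtain ⟨ω, hω, hle⟩ := (measure (List.length (α := B))).wf.has_min
    {ω | cs.wordProd ω • x₀ = y} ⟨υ, hw⟩
  simp only [Set.mem_ofPred_eq] at hω hle
  have hhgt := hqp.hgt_wordProd_smul_of_minimal hmin ω
    fun ω' h => not_lt.mp (hle ω' (h.trans hω))
  rw [hω] at hhgt
  refine ⟨cs.wordProd ω, hω, le_antisymm ?_ (hupper _ hω)⟩
  have := cs.length_wordProd_le ω
  omega
end

section
/- Suppose a quasiparabolic subgroup H ⊆ W contains an element of odd length. Then H contains a simple reflection, i.e., there exists s ∈ S with s ∈ H. -/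
open CoxeterSystem

variable {B W : Type*} [Group W] {M : CoxeterMatrix B}

/-- Height of a coset: the minimal length of a representative (as a natural number). -/
noncomputable def cosetHeightN (cs : CoxeterSystem M W) (H : Subgroup W) (x : W ⧸ H) : ℕ :=
  sInf {n : ℕ | ∃ v : W, (v : W ⧸ H) = x ∧ cs.length v = n}

/-- Height of a coset: the minimal length of a representative. -/
noncomputable def cosetHeight (cs : CoxeterSystem M W) (H : Subgroup W) (x : W ⧸ H) : ℤ :=
  (cosetHeightN cs H x : ℤ)

/-- A quasiparabolic subgroup: one for which `W ⧸ H` with the minimal-length height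
function is a quasiparabolic `W`-set. -/
def IsQuasiparabolicSubgroup (cs : CoxeterSystem M W) (H : Subgroup W) : Prop :=
  IsQuasiparabolic cs (cosetHeight cs H)

/-- A reflection that raises `x` keeps doing so after applying a simple reflection `b`,
unless `b` and the reflection move `x` to the same point. -/
theorem IsQuasiparabolic.simple_smul_lt {cs : CoxeterSystem M W} {X : Type*} [MulAction W X]
    {hgt : X → ℤ} (hX : IsQuasiparabolic cs hgt) {r : W} (hr : cs.IsReflection r) {x : X}
    (hlt : hgt x < hgt (r • x)) {b : B} (hne : r • x ≠ cs.simple b • x) :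
    hgt (cs.simple b • x) < hgt (cs.simple b • r • x) := by
  obtain ⟨-, qp1, qp2⟩ := hX
  rcases lt_trichotomy (hgt (cs.simple b • x)) (hgt (cs.simple b • r • x)) with h | h | h
  · exact h
  · have hconj := qp1 (cs.simple b * r * (cs.simple b)⁻¹) (cs.simple b • x)
      (hr.conj (cs.simple b)) (by simpa only [mul_smul, inv_smul_smul] using h.symm)
    have hfix : r • x = x := by
      simpa only [mul_smul, inv_smul_smul, smul_left_cancel_iff] using hconj
    rw [hfix] at hlt
    exact absurd hlt (lt_irrefl _)
  · exact absurd (qp2 r b x hr hlt h) hne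

/-- A simple reflection that moves `x` changes its height by exactly one. -/
theorem IsQuasiparabolic.hgt_simple_smul {cs : CoxeterSystem M W} {X : Type*} [MulAction W X]
    {hgt : X → ℤ} (hX : IsQuasiparabolic cs hgt) {b : B} {x : X} (hne : cs.simple b • x ≠ x) :
    hgt (cs.simple b • x) = hgt x + 1 ∨ hgt (cs.simple b • x) = hgt x - 1 := by
  have h := abs_le.mp (hX.1 b x)
  have h' : hgt (cs.simple b • x) ≠ hgt x :=
    fun h => hne (hX.2.1 _ _ (cs.isReflection_simple b) h)
  omega

/-- If simple reflections have no fixed points, then heights have the parity of the length. -/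
theorem IsQuasiparabolic.even_hgt_sub_sub_length {cs : CoxeterSystem M W} {X : Type*}
    [MulAction W X] {hgt : X → ℤ} (hX : IsQuasiparabolic cs hgt)
    (hfree : ∀ (b : B) (x : X), cs.simple b • x ≠ x) (w : W) (x : X) :
    Even (hgt (w • x) - hgt x - cs.length w) := by
  induction w using cs.simple_induction_left with
  | one => simp
  | mul_simple_left w b ih =>
    have hb := hX.hgt_simple_smul (hfree b (w • x))
    have hl := cs.length_simple_mul w b
    rw [mul_smul]
    rw [Int.even_iff] at ih ⊢
    omega

/-- Suppose simple reflections fix no point of height less than `N`. If alternately applying `a`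
and `b` starts with two descents from `p`, and `p` and `b • a • p` are related by a reflection,
then the descent never stops, so heights cannot be nonnegative. -/
theorem IsQuasiparabolic.not_alternating_descent {cs : CoxeterSystem M W} {X : Type*}
    [MulAction W X] {hgt : X → ℤ} (hX : IsQuasiparabolic cs hgt) (hnonneg : ∀ x, 0 ≤ hgt x)
    {N : ℤ} (hfree : ∀ (b : B) (x : X), hgt x < N → cs.simple b • x ≠ x) (n : ℕ) :
    ∀ (a b : B) (p : X) (r : W), cs.IsReflection r →
      r • cs.simple b • cs.simple a • p = p → hgt p = n → hgt p ≤ N →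
      hgt (cs.simple a • p) = hgt p - 1 →
      hgt (cs.simple b • cs.simple a • p) = hgt p - 2 → False := by
  induction n with
  | zero =>
    intro a b p r _ _ hn _ h1 _
    have := hnonneg (cs.simple a • p)
    push_cast at hn
    omega
  | succ n ih =>
    intro a b p r hr hrp hn hN h1 h2
    have hne : r • cs.simple b • cs.simple a • p ≠
        cs.simple a • cs.simple b • cs.simple a • p := by
      rw [hrp]
      intro h
      have h' : cs.simple a • p = cs.simple b • cs.simple a • p := by
        conv_lhs => rw [h]
        simp [smul_smul]
      rw [← h'] at h2
      omega
    have hlt := hX.simple_smul_lt hr (by rw [hrp]; omega) hne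
    rw [hrp] at hlt
    have hstep := hX.hgt_simple_smul (hfree a (cs.simple b • cs.simple a • p) (by omega))
    refine ih b a (cs.simple a • p) (cs.simple a * r * (cs.simple a)⁻¹) (hr.conj _) ?_
      (by push_cast at hn; omega) (by omega) (by omega) (by omega)
    simp only [mul_smul, inv_smul_smul, hrp]

/-- In a quasiparabolic set with nonnegative heights, if some simple reflection has a fixed point,
then some simple reflection fixes a point that no simple reflection lowers. -/
theorem IsQuasiparabolic.exists_simple_smul_eq_self {cs : CoxeterSystem M W} {X : Type*}
    [MulAction W X] {hgt : X → ℤ} (hX : IsQuasiparabolic cs hgt) (hnonneg : ∀ x, 0 ≤ hgt x)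
    (hfix : ∃ (b : B) (x : X), cs.simple b • x = x) :
    ∃ (b : B) (x : X), cs.simple b • x = x ∧ ∀ a : B, hgt x ≤ hgt (cs.simple a • x) := by
  obtain ⟨⟨b, x⟩, hbx, hmin⟩ := exists_minimalFor_of_wellFoundedLT
    (fun q : B × X => cs.simple q.1 • q.2 = q.2) (fun q => (hgt q.2).toNat)
    (by obtain ⟨b, x, h⟩ := hfix; exact ⟨(b, x), h⟩)
  dsimp only at hbx hmin
  have hfree : ∀ (c : B) (y : X), hgt y < hgt x → cs.simple c • y ≠ y := by
    intro c y hlt hy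
    have h1 := @hmin (c, y) hy
    have h2 := hnonneg y
    dsimp only at h1
    omega
  refine ⟨b, x, hbx, fun a => ?_⟩
  by_contra! hlt
  have ha : cs.simple a • cs.simple a • x = x := by simp [smul_smul]
  have h1 : hgt (cs.simple a • x) = hgt x - 1 := by
    have := hX.hgt_simple_smul (b := a) (x := x) (fun h => by rw [h] at hlt; omega)
    omega
  have hne : cs.simple a • cs.simple a • x ≠ cs.simple b • cs.simple a • x := by
    rw [ha]
    intro h
    have h' : cs.simple a • x = x := by
      have := congrArg (cs.simple b • ·) h
      simpa [smul_smul, ← mul_assoc, hbx] using this.symm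
    rw [h'] at hlt
    omega
  have h2 := hX.simple_smul_lt (cs.isReflection_simple a) (by rwa [ha]) hne
  rw [ha, hbx] at h2
  have h3 := hX.hgt_simple_smul (hfree b (cs.simple a • x) hlt)
  refine hX.not_alternating_descent hnonneg hfree (hgt x).toNat a b x
    (cs.simple b * cs.simple a * (cs.simple b)⁻¹) ((cs.isReflection_simple a).conj _) ?_
    (Int.toNat_of_nonneg (hnonneg x)).symm le_rfl h1 (by omega)
  simp only [mul_smul, inv_smul_smul, ha, hbx]

theorem cosetHeightN_mk_le (cs : CoxeterSystem M W) (H : Subgroup W) (v : W) :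
    cosetHeightN cs H (v : W ⧸ H) ≤ cs.length v :=
  Nat.sInf_le ⟨v, rfl, rfl⟩

theorem exists_length_eq_cosetHeightN (cs : CoxeterSystem M W) (H : Subgroup W) (x : W ⧸ H) :
    ∃ v : W, (v : W ⧸ H) = x ∧ cs.length v = cosetHeightN cs H x := by
  obtain ⟨v, rfl⟩ := QuotientGroup.mk_surjective x
  exact Nat.sInf_mem (s := {n : ℕ | ∃ u : W, (u : W ⧸ H) = v ∧ cs.length u = n}) ⟨_, v, rfl, rfl⟩

/-- The only coset whose height is not lowered by any simple reflection is the trivial one. -/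
theorem eq_one_of_cosetHeight_le (cs : CoxeterSystem M W) (H : Subgroup W) (x : W ⧸ H)
    (hx : ∀ a : B, cosetHeight cs H x ≤ cosetHeight cs H (cs.simple a • x)) :
    x = ((1 : W) : W ⧸ H) := by
  obtain ⟨v, rfl, hv⟩ := exists_length_eq_cosetHeightN cs H x
  by_contra hne
  obtain ⟨a, ha⟩ := cs.exists_leftDescent_of_ne_one (w := v) (by rintro rfl; exact hne rfl)
  have h1 := cosetHeightN_mk_le cs H (cs.simple a * v)
  have h2 : cosetHeightN cs H (v : W ⧸ H) ≤
      cosetHeightN cs H ((cs.simple a * v : W) : W ⧸ H) := by exact Int.ofNat_le.mp (hx a)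
  unfold CoxeterSystem.IsLeftDescent at ha
  omega

/-- a quasiparabolic subgroup containing an element of odd length
contains a simple reflection. -/
theorem odd_quasiparabolic_has_simple (cs : CoxeterSystem M W) (H : Subgroup W)
    (hqp : IsQuasiparabolicSubgroup cs H)
    (hodd : ∃ h ∈ H, Odd (cs.length h)) :
    ∃ b : B, cs.simple b ∈ H := by
  have hfix : ∃ (b : B) (x : W ⧸ H), cs.simple b • x = x := by
    by_contra! hfree
    obtain ⟨h, hH, hodd⟩ := hodd
    have heven := IsQuasiparabolic.even_hgt_sub_sub_length hqp hfree h ((1 : W) : W ⧸ H)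
    have hh : h • ((1 : W) : W ⧸ H) = ((1 : W) : W ⧸ H) := by
      rw [MulAction.Quotient.smul_coe, QuotientGroup.eq]
      simpa using hH
    rw [hh, sub_self, zero_sub, even_neg, Int.even_coe_nat] at heven
    exact Nat.not_even_iff_odd.mpr hodd heven
  obtain ⟨b, x, hbx, hx⟩ :=
    IsQuasiparabolic.exists_simple_smul_eq_self hqp (fun _ => Int.natCast_nonneg _) hfix
  obtain rfl := eq_one_of_cosetHeight_le cs H x hx
  refine ⟨b, ?_⟩
  rw [MulAction.Quotient.smul_coe, QuotientGroup.eq] at hbx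
  simpa using hbx
end

section
/- Let ι ∈ W be a perfect involution and r ∈ R(W). If ℓ(ι) < ℓ(rι) and ℓ(rιr) < ℓ(rι), then ι = rιr; likewise, if ℓ(ι) > ℓ(rι) and ℓ(rιr) > ℓ(rι), then ι = rιr. (Note that ℓ(rι) = ℓ(ιr) since ι is an involution.) -/
open CoxeterSystem

variable {B W : Type*} [Group W] {M : CoxeterMatrix B}

/-- A perfect involution: an involution `ι` such that every reflection `r`
commutes with `ι r ι`. -/
def IsPerfectInvolution (cs : CoxeterSystem M W) (ι : W) : Prop :=
  ι * ι = 1 ∧ ∀ r : W, cs.IsReflection r → Commute r (ι * r * ι)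

namespace CoxeterSystem

variable (cs : CoxeterSystem M W)

open scoped Classical in
/-- The action of a simple reflection on signed group elements: conjugate the element, and flip
the sign precisely when the element is that simple reflection. -/
noncomputable def signedConj (i : B) : Function.End (W × ZMod 2) :=
  fun x ↦ (cs.simple i * x.1 * cs.simple i, x.2 + if x.1 = cs.simple i then 1 else 0)

open scoped Classical in
theorem prod_map_signedConj (ω : List B) (x : W × ZMod 2) :
    (ω.map cs.signedConj).prod x =
      (cs.wordProd ω * x.1 * (cs.wordProd ω)⁻¹, x.2 + ((cs.rightInvSeq ω).count x.1 : ZMod 2)) := by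
  induction ω with
  | nil =>
    simp only [List.map_nil, List.prod_nil, wordProd_nil, rightInvSeq_nil, List.count_nil]
    change x = _
    simp
  | cons i ω ih =>
    rw [List.map_cons, List.prod_cons]
    change cs.signedConj i ((ω.map cs.signedConj).prod x) = _
    rw [ih]
    have key : cs.wordProd ω * x.1 * (cs.wordProd ω)⁻¹ = cs.simple i ↔
        (cs.wordProd ω)⁻¹ * cs.simple i * cs.wordProd ω = x.1 := by
      constructor
      · intro h
        rw [← h]
        group
      · intro h
        rw [← h]
        group
    simp only [signedConj, rightInvSeq, wordProd_cons, List.count_cons, key, beq_iff_eq]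
    refine Prod.ext ?_ ?_
    · simp [mul_assoc]
    · push_cast
      ring

theorem prod_map_alternatingWord {N : Type*} [Monoid N] (f : B → N) (i j : B) (m : ℕ) :
    ((alternatingWord i j (2 * m)).map f).prod = (f i * f j) ^ m := by
  induction m with
  | zero => simp [alternatingWord]
  | succ m ih =>
    rw [show 2 * (m + 1) = 2 * m + 1 + 1 by ring, alternatingWord_succ, alternatingWord_succ]
    simp [List.concat_eq_append, ih, pow_succ]

/-- The left inversion sequence of a full braid word consists of two equal halves. -/
theorem leftInvSeq_braidWord (i j : B) :
    cs.leftInvSeq (alternatingWord i j (2 * M i j)) =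
      (cs.leftInvSeq (alternatingWord i j (2 * M i j))).take (M i j) ++
        (cs.leftInvSeq (alternatingWord i j (2 * M i j))).take (M i j) := by
  have hlen : (cs.leftInvSeq (alternatingWord i j (2 * M i j))).length = 2 * M i j := by simp
  conv_lhs => rw [← List.take_append_drop (M i j) (cs.leftInvSeq _)]
  congr 1
  apply List.ext_getElem
  · simp only [List.length_drop, List.length_take, hlen]
    omega
  · intro k h₁ h₂
    have hk : k < M i j := by
      simp only [List.length_drop, hlen] at h₁
      omega
    rw [List.getElem_drop, List.getElem_take,
      cs.getElem_leftInvSeq_alternatingWord i j (M i j) (M i j + k) (by omega),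
      cs.getElem_leftInvSeq_alternatingWord i j (M i j) k (by omega),
      prod_alternatingWord_eq_mul_pow, prod_alternatingWord_eq_mul_pow]
    have e₁ : (2 * (M i j + k) + 1) / 2 = M i j + k := by omega
    have e₂ : (2 * k + 1) / 2 = k := by omega
    have o₁ : ¬ Even (2 * (M i j + k) + 1) := by simp
    have o₂ : ¬ Even (2 * k + 1) := by simp
    rw [e₁, e₂, if_neg o₁, if_neg o₂, pow_add]
    simp

theorem leftInvSeq_eq_map_conj_rightInvSeq (ω : List B) :
    cs.leftInvSeq ω = (cs.rightInvSeq ω).map (MulAut.conj (cs.wordProd ω)) := by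
  induction ω with
  | nil => simp
  | cons i ω ih =>
    rw [leftInvSeq, rightInvSeq, ih, List.map_cons, List.map_map, wordProd_cons, map_mul]
    simp [mul_assoc]

theorem isLiftable_signedConj : M.IsLiftable cs.signedConj := by
  classical
  intro i j
  rw [← prod_map_alternatingWord]
  funext x
  rw [prod_map_signedConj]
  have hw : cs.wordProd (alternatingWord i j (2 * M i j)) = 1 := by
    rw [wordProd, prod_map_alternatingWord, simple_mul_simple_pow]
  have hc : ((cs.rightInvSeq (alternatingWord i j (2 * M i j))).count x.1 : ZMod 2) = 0 := by
    have hrev : cs.rightInvSeq (alternatingWord i j (2 * M i j)) =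
        cs.leftInvSeq (alternatingWord i j (2 * M i j)) := by
      rw [leftInvSeq_eq_map_conj_rightInvSeq, hw]
      simp
    rw [hrev, leftInvSeq_braidWord, List.count_append]
    push_cast
    exact CharTwo.add_self_eq_zero _
  rw [hw, hc]
  change _ = x
  simp

/-- The parity of the number of occurrences of `t` in the right inversion sequence of any word
for `w`. -/
noncomputable def inversionParity (w t : W) : ZMod 2 :=
  (cs.lift ⟨cs.signedConj, cs.isLiftable_signedConj⟩ w (t, 0)).2

open scoped Classical in
theorem lift_signedConj_wordProd (ω : List B) (x : W × ZMod 2) :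
    cs.lift ⟨cs.signedConj, cs.isLiftable_signedConj⟩ (cs.wordProd ω) x =
      (cs.wordProd ω * x.1 * (cs.wordProd ω)⁻¹, x.2 + ((cs.rightInvSeq ω).count x.1 : ZMod 2)) := by
  rw [← prod_map_signedConj, wordProd, map_list_prod, List.map_map]
  have h : cs.lift ⟨cs.signedConj, cs.isLiftable_signedConj⟩ ∘ cs.simple = cs.signedConj :=
    funext (cs.lift_apply_simple cs.isLiftable_signedConj)
  rw [h]

open scoped Classical in
theorem inversionParity_wordProd (ω : List B) (t : W) :
    cs.inversionParity (cs.wordProd ω) t = (cs.rightInvSeq ω).count t := by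
  rw [inversionParity, lift_signedConj_wordProd, zero_add]

theorem lift_signedConj_apply (w : W) (x : W × ZMod 2) :
    cs.lift ⟨cs.signedConj, cs.isLiftable_signedConj⟩ w x =
      (w * x.1 * w⁻¹, x.2 + cs.inversionParity w x.1) := by
  obtain ⟨ω, -, rfl⟩ := cs.exists_isReduced w
  rw [lift_signedConj_wordProd, inversionParity_wordProd]

theorem inversionParity_mul (u v t : W) :
    cs.inversionParity (u * v) t =
      cs.inversionParity v t + cs.inversionParity u (v * t * v⁻¹) := by
  conv_lhs => rw [inversionParity, map_mul]
  change (cs.lift ⟨cs.signedConj, _⟩ u (cs.lift ⟨cs.signedConj, _⟩ v (t, 0))).2 = _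
  rw [lift_signedConj_apply, lift_signedConj_apply, zero_add]

@[simp]
theorem inversionParity_one (t : W) : cs.inversionParity 1 t = 0 := by
  classical
  simpa using cs.inversionParity_wordProd [] t

open scoped Classical in
theorem inversionParity_simple (i : B) (t : W) :
    cs.inversionParity (cs.simple i) t = if t = cs.simple i then 1 else 0 := by
  have h := cs.inversionParity_wordProd [i] t
  rw [wordProd_singleton] at h
  rw [h]
  by_cases ht : t = cs.simple i
  · simp [ht]
  · simp [ht, Ne.symm ht]

/-- The only reflection commuting with a reflection `r` that is an inversion of `r` is `r`. -/
theorem inversionParity_of_commute {r : W} (hr : cs.IsReflection r) {t : W} (h : Commute r t)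
    [Decidable (t = r)] :
    cs.inversionParity r t = if t = r then 1 else 0 := by
  obtain ⟨u, i, rfl⟩ := hr
  have hfix : cs.simple i * (u⁻¹ * t * u) * (cs.simple i)⁻¹ = u⁻¹ * t * u := by
    have h' := h.eq
    calc _ = u⁻¹ * (u * cs.simple i * u⁻¹ * t) * u * (cs.simple i)⁻¹ := by group
      _ = _ := by rw [h']; group
  have hcancel : cs.inversionParity u⁻¹ t + cs.inversionParity u (u⁻¹ * t * u) = 0 := by
    simpa using (cs.inversionParity_mul u u⁻¹ t).symm
  have hiff : u⁻¹ * t * u = cs.simple i ↔ t = u * cs.simple i * u⁻¹ := by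
    constructor
    · intro e
      rw [← e]
      group
    · intro e
      rw [e]
      group
  classical
  rw [inversionParity_mul, inversionParity_mul, inv_inv, hfix, inversionParity_simple]
  simp only [hiff]
  linear_combination hcancel

theorem isRightInversion_of_inversionParity_ne_zero {w t : W} (h : cs.inversionParity w t ≠ 0) :
    cs.IsRightInversion w t := by
  classical
  obtain ⟨ω, hω, rfl⟩ := cs.exists_isReduced w
  rw [inversionParity_wordProd] at h
  apply cs.isRightInversion_of_mem_rightInvSeq hω
  by_contra hmem
  exact h (by simp [List.count_eq_zero_of_not_mem hmem])

theorem inversionParity_ne_zero_iff {w t : W} (ht : cs.IsReflection t) :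
    cs.inversionParity w t ≠ 0 ↔ cs.length (w * t) < cs.length w := by
  classical
  refine ⟨fun h ↦ (cs.isRightInversion_of_inversionParity_ne_zero h).2, fun hlt h ↦ ?_⟩
  have hwt : cs.inversionParity (w * t) t ≠ 0 := by
    rw [inversionParity_mul, cs.inversionParity_of_commute ht (Commute.refl t)]
    simp [h]
  have := (cs.isRightInversion_of_inversionParity_ne_zero hwt).2
  rw [mul_assoc, ht.mul_self, mul_one] at this
  exact hlt.not_gt this

end CoxeterSystem

/-- for a perfect involution `ι` and a reflection `r`, if
`ℓ(ι), ℓ(rιr) < ℓ(rι)` or `ℓ(ι), ℓ(rιr) > ℓ(rι)`, then `ι = rιr`. -/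
theorem perfect_involution_length_between (cs : CoxeterSystem M W) (ι : W)
    (hι : IsPerfectInvolution cs ι) (r : W) (hr : cs.IsReflection r) :
    (cs.length ι < cs.length (r * ι) → cs.length (r * ι * r) < cs.length (r * ι) →
      ι = r * ι * r) ∧
    (cs.length (r * ι) < cs.length ι → cs.length (r * ι) < cs.length (r * ι * r) →
      ι = r * ι * r) := by
  obtain ⟨hsq, hcomm⟩ := hι
  have hinv : ι⁻¹ = ι := inv_eq_of_mul_eq_one_left hsq
  have hlen : cs.length (ι * r) = cs.length (r * ι) := by
    rw [← cs.length_inv, mul_inv_rev, hinv, hr.inv]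
  have hparity : cs.inversionParity (r * ι) r =
      cs.inversionParity ι r + cs.inversionParity r (ι * r * ι) := by
    rw [cs.inversionParity_mul, hinv]
  have h₁ := cs.inversionParity_ne_zero_iff (w := ι) hr
  have h₂ := cs.inversionParity_ne_zero_iff (w := r * ι) hr
  rw [hlen] at h₁
  have key : cs.inversionParity r (ι * r * ι) ≠ 0 → ι = r * ι * r := by
    classical
    intro h
    rw [cs.inversionParity_of_commute hr (hcomm r hr)] at h
    have hfix : ι * r * ι = r := by
      by_contra hne
      simp [hne] at h
    calc ι = ι * (r * r) := by rw [hr.mul_self, mul_one]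
      _ = ι * r * (ι * ι) * r := by rw [hsq, mul_one, mul_assoc]
      _ = (ι * r * ι) * ι * r := by simp only [mul_assoc]
      _ = r * ι * r := by rw [hfix]
  constructor
  · intro hlt hlt'
    refine key fun h ↦ h₂.mpr hlt' ?_
    rw [hparity, h, add_zero]
    exact not_not.mp fun h' ↦ hlt.not_gt (h₁.mp h')
  · intro hlt hlt'
    refine key fun h ↦ hlt'.not_gt (h₂.mp ?_)
    rw [hparity, h, add_zero]
    exact h₁.mpr hlt
end
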